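/- For every memory-2 strategy tau in [0,1]^21, every payoff vector g in R^4, and every w in (0,1], there exists a deterministic memory-2 strategy sigma* in {0,1}^21 such that pi2_{w,g}(sigma*,tau) >= pi2_{w,g}(sigma,tau) for all memory-2 strategies sigma in [0,1]^21. Hence to verify that a memory-2 strategy is a Nash equilibrium within memory-2 strategies it suffices to perform the 2^21 payoff comparisons against deterministic memory-2 deviations. -/

import Mathlib

open Matrix

noncomputable section

/-! ## Memory-2 setting -/

/-- Swapping an outcome to the co-player's perspective: LL ↦ LL, LR ↦ RL,
RL ↦ LR, RR ↦ RR. -/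
def swap4 : Fin 4 → Fin 4 := ![0, 2, 1, 3]

/-- Distribution over the outcomes (LL, LR, RL, RR) from player 1's perspective
when player 1 cooperates with probability `c1` and player 2 with probability
`c2`, independently. -/
def outProb (c1 c2 : ℝ) : Fin 4 → ℝ :=
  ![c1 * c2, c1 * (1 - c2), (1 - c1) * c2, (1 - c1) * (1 - c2)]

/-- Round-1 cooperation probability of a memory-2 strategy. -/
def m2r1 (σ : Fin 21 → ℝ) : ℝ := σ 0

/-- Round-2 cooperation probability of a memory-2 strategy after round-1
outcome `o`. -/
def m2r2 (σ : Fin 21 → ℝ) (o : Fin 4) : ℝ :=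
  σ ⟨1 + o.val, by have := o.isLt; omega⟩

/-- Later-round cooperation probability of a memory-2 strategy after last
outcome `o₁` and second-to-last outcome `o₂`. -/
def m2c (σ : Fin 21 → ℝ) (o₁ o₂ : Fin 4) : ℝ :=
  σ ⟨5 + 4 * o₁.val + o₂.val, by have := o₁.isLt; have := o₂.isLt; omega⟩

/-- Initial distribution over states `(o₋₂, o₋₁)` (round-1 outcome, round-2
outcome), recorded from player 1's perspective, for memory-2 strategies
`σ` (player 1) and `τ` (player 2). -/
def V0 (σ τ : Fin 21 → ℝ) : Fin 4 × Fin 4 → ℝ := fun s =>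
  outProb (m2r1 σ) (m2r1 τ) s.1 * outProb (m2r2 σ s.1) (m2r2 τ (swap4 s.1)) s.2

/-- Transition matrix on the 16 states `(o₋₂, o₋₁)` of consecutive outcome
pairs for memory-2 strategies `σ` (player 1) and `τ` (player 2); each player
reads outcomes from their own perspective. -/
def T (σ τ : Fin 21 → ℝ) : Matrix (Fin 4 × Fin 4) (Fin 4 × Fin 4) ℝ :=
  Matrix.of fun s s' =>
    if s'.1 = s.2 then
      outProb (m2c σ s.2 s.1) (m2c τ (swap4 s.2) (swap4 s.1)) s'.2
    else 0

/-- Payoff vector on states: the state `(o₋₂, o₋₁)` pays player 1's stage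
payoff at the last outcome `o₋₁`. -/
def ghat (g : Fin 4 → ℝ) : Fin 4 × Fin 4 → ℝ := fun s => g s.2

/-- Player 1's expected per-round payoff `π2_{w,g}(σ,τ)` between two memory-2
strategies. -/
def payoff2 (w : ℝ) (g : Fin 4 → ℝ) (σ τ : Fin 21 → ℝ) : ℝ :=
  w * ((V0 σ τ ᵥ* (1 - (1 - w) • T σ τ)⁻¹) ⬝ᵥ ghat g)

/-- Expected value of `f` at the next outcome. -/
def expOut (p q : ℝ) (f : Fin 4 → ℝ) : ℝ := ∑ o, outProb p q o * f o

lemma expOut_eq (p q : ℝ) (f : Fin 4 → ℝ) :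
    expOut p q f = p * (q * f 0 + (1 - q) * f 1) + (1 - p) * (q * f 2 + (1 - q) * f 3) := by
  simp [expOut, outProb, Fin.sum_univ_four]
  ring

lemma expOut_mono {p q : ℝ} (hp : p ∈ Set.Icc (0 : ℝ) 1) (hq : q ∈ Set.Icc (0 : ℝ) 1)
    {f f' : Fin 4 → ℝ} (h : ∀ o, f o ≤ f' o) : expOut p q f ≤ expOut p q f' := by
  obtain ⟨hp0, hp1⟩ := hp
  obtain ⟨hq0, hq1⟩ := hq
  have hp' : 0 ≤ 1 - p := by linarith
  have hq' : 0 ≤ 1 - q := by linarith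
  rw [expOut_eq, expOut_eq]
  have := h 0
  have := h 1
  have := h 2
  have := h 3
  gcongr

lemma expOut_const (p q c : ℝ) : expOut p q (fun _ => c) = c := by
  rw [expOut_eq]; ring

/-- The greedy action. -/
def greedy (q : ℝ) (f : Fin 4 → ℝ) : ℝ := if expOut 0 q f ≤ expOut 1 q f then 1 else 0

lemma greedy_det (q : ℝ) (f : Fin 4 → ℝ) : greedy q f = 0 ∨ greedy q f = 1 := by
  unfold greedy; split_ifs <;> simp

lemma expOut_greedy (q : ℝ) (f : Fin 4 → ℝ) :
    expOut (greedy q f) q f = max (expOut 0 q f) (expOut 1 q f) := by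
  unfold greedy
  split_ifs with h
  · rw [max_eq_right h]
  · rw [max_eq_left (le_of_not_ge h)]

lemma expOut_le_greedy {p : ℝ} (hp : p ∈ Set.Icc (0 : ℝ) 1) (q : ℝ) (f : Fin 4 → ℝ) :
    expOut p q f ≤ expOut (greedy q f) q f := by
  rw [expOut_greedy]
  have h0 := le_max_left (expOut 0 q f) (expOut 1 q f)
  have h1 := le_max_right (expOut 0 q f) (expOut 1 q f)
  have h : expOut p q f = (1 - p) * expOut 0 q f + p * expOut 1 q f := by
    simp only [expOut_eq]; ring
  have h2 := mul_le_mul_of_nonneg_left h0 (by linarith [hp.2] : 0 ≤ 1 - p)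
  have h3 := mul_le_mul_of_nonneg_left h1 hp.1
  rw [h]
  linarith

/-- Assemble a memory-2 strategy. -/
def mkStrat (b0 : ℝ) (b1 : Fin 4 → ℝ) (b2 : Fin 4 → Fin 4 → ℝ) : Fin 21 → ℝ := fun i =>
  if i.val = 0 then b0
  else if i.val < 5 then b1 (Fin.ofNat 4 (i.val - 1))
  else b2 (Fin.ofNat 4 ((i.val - 5) / 4)) (Fin.ofNat 4 ((i.val - 5) % 4))

lemma m2r1_mk (b0 : ℝ) (b1 : Fin 4 → ℝ) (b2 : Fin 4 → Fin 4 → ℝ) :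
    m2r1 (mkStrat b0 b1 b2) = b0 := by
  simp [m2r1, mkStrat]

lemma m2r2_mk (b0 : ℝ) (b1 : Fin 4 → ℝ) (b2 : Fin 4 → Fin 4 → ℝ) (o : Fin 4) :
    m2r2 (mkStrat b0 b1 b2) o = b1 o := by
  fin_cases o <;> simp [m2r2, mkStrat, Fin.ofNat]

lemma m2c_mk (b0 : ℝ) (b1 : Fin 4 → ℝ) (b2 : Fin 4 → Fin 4 → ℝ) (o o' : Fin 4) :
    m2c (mkStrat b0 b1 b2) o o' = b2 o o' := by
  fin_cases o <;> fin_cases o' <;> simp [m2c, mkStrat, Fin.ofNat]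

lemma T_mulVec (σ τ : Fin 21 → ℝ) (d : Fin 4 × Fin 4 → ℝ) (s : Fin 4 × Fin 4) :
    (T σ τ *ᵥ d) s =
      expOut (m2c σ s.2 s.1) (m2c τ (swap4 s.2) (swap4 s.1)) (fun o => d (s.2, o)) := by
  simp [Matrix.mulVec, dotProduct, T, expOut, Fintype.sum_prod_type, ite_mul,
    Finset.sum_ite_irrel]

lemma V0_dot (σ τ : Fin 21 → ℝ) (x : Fin 4 × Fin 4 → ℝ) :
    V0 σ τ ⬝ᵥ x = expOut (m2r1 σ) (m2r1 τ) (fun o =>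
      expOut (m2r2 σ o) (m2r2 τ (swap4 o)) (fun o' => x (o, o'))) := by
  simp [dotProduct, V0, expOut, Fintype.sum_prod_type, Finset.mul_sum, mul_assoc]

lemma nonneg_of_ge {σ τ : Fin 21 → ℝ} (hσ : ∀ i, σ i ∈ Set.Icc (0 : ℝ) 1)
    (hτ : ∀ i, τ i ∈ Set.Icc (0 : ℝ) 1) {w : ℝ} (hw : w ∈ Set.Ioc (0 : ℝ) 1)
    (d : Fin 4 × Fin 4 → ℝ) (h : ∀ s, (1 - w) * (T σ τ *ᵥ d) s ≤ d s) (s : Fin 4 × Fin 4) :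
    0 ≤ d s := by
  obtain ⟨s0, hs0⟩ := Finite.exists_min d
  have h1 := h s0
  have h2 : d s0 ≤ (T σ τ *ᵥ d) s0 := by
    rw [T_mulVec]
    calc d s0 = expOut (m2c σ s0.2 s0.1) (m2c τ (swap4 s0.2) (swap4 s0.1)) (fun _ => d s0) :=
          (expOut_const _ _ _).symm
      _ ≤ _ := expOut_mono (hσ _) (hτ _) (fun o => hs0 _)
  have h3 := mul_le_mul_of_nonneg_left h2 (by linarith [hw.2] : 0 ≤ 1 - w)
  have h4 : 0 ≤ w * d s0 := by linarith
  exact (nonneg_of_mul_nonneg_right h4 hw.1).trans (hs0 s)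

lemma sub_mulVec_apply (w : ℝ) (σ τ : Fin 21 → ℝ) (d : Fin 4 × Fin 4 → ℝ)
    (s : Fin 4 × Fin 4) :
    ((1 - (1 - w) • T σ τ) *ᵥ d) s = d s - (1 - w) * (T σ τ *ᵥ d) s := by
  simp [Matrix.sub_mulVec, Matrix.smul_mulVec]

lemma isUnit_M {σ τ : Fin 21 → ℝ} (hσ : ∀ i, σ i ∈ Set.Icc (0 : ℝ) 1)
    (hτ : ∀ i, τ i ∈ Set.Icc (0 : ℝ) 1) {w : ℝ} (hw : w ∈ Set.Ioc (0 : ℝ) 1) :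
    IsUnit (1 - (1 - w) • T σ τ).det := by
  rw [isUnit_iff_ne_zero]
  intro hdet
  obtain ⟨v, hv, hv0⟩ := Matrix.exists_mulVec_eq_zero_iff.mpr hdet
  apply hv
  have key : ∀ s, v s - (1 - w) * (T σ τ *ᵥ v) s = 0 := fun s => by
    rw [← sub_mulVec_apply, hv0]; rfl
  funext s
  have h1 := nonneg_of_ge hσ hτ hw v (fun s => by linarith [key s]) s
  have h2 := nonneg_of_ge hσ hτ hw (-v) (fun s => by
    rw [Matrix.mulVec_neg]
    simp only [Pi.neg_apply]
    linarith [key s]) s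
  simp only [Pi.neg_apply] at h2
  simp only [Pi.zero_apply]
  linarith

lemma payoff2_eq (w : ℝ) (g : Fin 4 → ℝ) (σ τ : Fin 21 → ℝ) :
    payoff2 w g σ τ = w * (V0 σ τ ⬝ᵥ ((1 - (1 - w) • T σ τ)⁻¹ *ᵥ ghat g)) := by
  rw [payoff2, Matrix.dotProduct_mulVec]

/-- The Bellman operator. -/
def bellman (w : ℝ) (g : Fin 4 → ℝ) (τ : Fin 21 → ℝ) (v : Fin 4 × Fin 4 → ℝ) :
    Fin 4 × Fin 4 → ℝ := fun s =>
  g s.2 + (1 - w) * max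
    (expOut 0 (m2c τ (swap4 s.2) (swap4 s.1)) (fun o => v (s.2, o)))
    (expOut 1 (m2c τ (swap4 s.2) (swap4 s.1)) (fun o => v (s.2, o)))

lemma expOut_abs_sub {p q : ℝ} (hp : p ∈ Set.Icc (0 : ℝ) 1) (hq : q ∈ Set.Icc (0 : ℝ) 1)
    {f f' : Fin 4 → ℝ} {c : ℝ} (h : ∀ o, |f o - f' o| ≤ c) :
    |expOut p q f - expOut p q f'| ≤ c := by
  have hs : expOut p q f - expOut p q f' = expOut p q (fun o => f o - f' o) := by
    simp only [expOut_eq]; ring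
  rw [hs, abs_le]
  constructor
  · rw [← expOut_const p q (-c)]
    exact expOut_mono hp hq fun o => (abs_le.mp (h o)).1
  · refine le_of_le_of_eq ?_ (expOut_const p q c)
    exact expOut_mono hp hq fun o => (abs_le.mp (h o)).2

lemma bellman_fixed {τ : Fin 21 → ℝ} (hτ : ∀ i, τ i ∈ Set.Icc (0 : ℝ) 1)
    (g : Fin 4 → ℝ) {w : ℝ} (hw : w ∈ Set.Ioc (0 : ℝ) 1) :
    ∃ v, bellman w g τ v = v := by
  have hw0 : 0 ≤ 1 - w := by linarith [hw.2]
  have hc : ContractingWith (Real.toNNReal (1 - w)) (bellman w g τ) := by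
    constructor
    · rw [← NNReal.coe_lt_coe, Real.coe_toNNReal _ hw0, NNReal.coe_one]
      linarith [hw.1]
    · apply LipschitzWith.of_dist_le_mul
      intro x y
      rw [Real.coe_toNNReal _ hw0]
      rw [dist_pi_le_iff (by positivity)]
      intro s
      rw [Real.dist_eq]
      have e : ∀ a b c : ℝ, (c + (1 - w) * a) - (c + (1 - w) * b) = (1 - w) * (a - b) := by
        intros; ring
      simp only [bellman]
      rw [e, abs_mul, abs_of_nonneg hw0]
      refine mul_le_mul_of_nonneg_left ?_ hw0
      refine (abs_max_sub_max_le_max _ _ _ _).trans (max_le ?_ ?_)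
      · exact expOut_abs_sub (by simp) (hτ _) fun o => by
          rw [← Real.dist_eq]; exact dist_le_pi_dist x y _
      · exact expOut_abs_sub (by simp) (hτ _) fun o => by
          rw [← Real.dist_eq]; exact dist_le_pi_dist x y _
  exact ⟨_, hc.fixedPoint_isFixedPt⟩

/-- Among memory-2 strategies, the best-response payoff against a fixed
memory-2 strategy is attained at a vertex of the cube `[0,1]^21`, i.e. at a
deterministic memory-2 strategy; hence the `2^21` comparisons against
deterministic deviations suffice to verify Nash equilibrium within memory-2
strategies. -/
theorem stmt19 (τ : Fin 21 → ℝ) (hτ : ∀ i, τ i ∈ Set.Icc (0 : ℝ) 1)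
    (g : Fin 4 → ℝ) (w : ℝ) (hw : w ∈ Set.Ioc (0 : ℝ) 1) :
    ∃ σstar : Fin 21 → ℝ, (∀ i, σstar i = 0 ∨ σstar i = 1) ∧
      ∀ σ : Fin 21 → ℝ, (∀ i, σ i ∈ Set.Icc (0 : ℝ) 1) →
        payoff2 w g σ τ ≤ payoff2 w g σstar τ := by
  obtain ⟨v, hv⟩ := bellman_fixed hτ g hw
  have hw0 : 0 ≤ 1 - w := by linarith [hw.2]
  let b2 : Fin 4 → Fin 4 → ℝ := fun o o' =>
    greedy (m2c τ (swap4 o) (swap4 o')) (fun a => v (o, a))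
  let b1 : Fin 4 → ℝ := fun o => greedy (m2r2 τ (swap4 o)) (fun a => v (o, a))
  let b0 : ℝ := greedy (m2r1 τ) (fun o =>
    expOut (b1 o) (m2r2 τ (swap4 o)) (fun o' => v (o, o')))
  have hdet : ∀ i, mkStrat b0 b1 b2 i = 0 ∨ mkStrat b0 b1 b2 i = 1 := by
    intro i
    unfold mkStrat
    split_ifs <;> exact greedy_det _ _
  have hmem : ∀ i, mkStrat b0 b1 b2 i ∈ Set.Icc (0 : ℝ) 1 := by
    intro i
    rcases hdet i with h | h <;> rw [h] <;> simp
  have hvs : ∀ s : Fin 4 × Fin 4, v s = g s.2 + (1 - w) *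
      expOut (b2 s.2 s.1) (m2c τ (swap4 s.2) (swap4 s.1)) (fun o => v (s.2, o)) := by
    intro s
    conv_lhs => rw [← hv]
    simp only [b2]
    rw [expOut_greedy]
    rfl
  refine ⟨mkStrat b0 b1 b2, hdet, fun σ hσ => ?_⟩
  have hstar : (1 - (1 - w) • T (mkStrat b0 b1 b2) τ)⁻¹ *ᵥ ghat g = v := by
    have : ghat g = (1 - (1 - w) • T (mkStrat b0 b1 b2) τ) *ᵥ v := by
      funext s
      rw [sub_mulVec_apply, T_mulVec, m2c_mk]
      have := hvs s
      simp only [ghat]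
      linarith
    rw [this, Matrix.mulVec_mulVec, Matrix.nonsing_inv_mul _ (isUnit_M hmem hτ hw),
      Matrix.one_mulVec]
  rw [payoff2_eq, payoff2_eq, hstar, V0_dot, V0_dot, m2r1_mk]
  simp only [m2r2_mk]
  refine mul_le_mul_of_nonneg_left ?_ hw.1.le
  set x := (1 - (1 - w) • T σ τ)⁻¹ *ᵥ ghat g with hx
  have hx2 : (1 - (1 - w) • T σ τ) *ᵥ x = ghat g := by
    rw [hx, Matrix.mulVec_mulVec, Matrix.mul_nonsing_inv _ (isUnit_M hσ hτ hw),
      Matrix.one_mulVec]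
  have hle : ∀ s, x s ≤ v s := by
    intro s
    have := nonneg_of_ge hσ hτ hw (v - x) (fun s => by
      have h1 := congrFun hx2 s
      rw [sub_mulVec_apply] at h1
      simp only [ghat] at h1
      have h2 : (T σ τ *ᵥ v) s ≤
          expOut (b2 s.2 s.1) (m2c τ (swap4 s.2) (swap4 s.1)) (fun o => v (s.2, o)) := by
        rw [T_mulVec]
        exact expOut_le_greedy (hσ _) _ _
      have h3 := mul_le_mul_of_nonneg_left h2 hw0
      have h4 := hvs s
      rw [Matrix.mulVec_sub]
      simp only [Pi.sub_apply]
      linarith) s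
    simp only [Pi.sub_apply] at this
    linarith
  calc _ ≤ expOut (m2r1 σ) (m2r1 τ) (fun o =>
        expOut (b1 o) (m2r2 τ (swap4 o)) (fun o' => v (o, o'))) := by
        refine expOut_mono (hσ _) (hτ _) fun o => ?_
        exact (expOut_mono (hσ _) (hτ _) fun o' => hle _).trans
          (expOut_le_greedy (hσ _) _ _)
    _ ≤ _ := expOut_le_greedy (hσ _) _ _
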